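/- arXiv:2105.05703 — 5 statements merged into one kernel-verified Lean document; each statement's English description precedes it below -/
import Mathlib

section
/- Let S be a positive integer, let B : ℝ → Matrix (Fin S) (Fin S) ℝ have continuous entries, and let α : ℝ → ℝ be continuous. Fix t₁ < t₂ and suppose that for every t ∈ (t₁, t₂) and every column index j one has ∑_{i} B(t)_{ij} ≤ −α(t). Let w : (t₁, t₂) → (Fin S → ℝ) be differentiable with w'(t) = B(t) ·ᵥ w(t) (matrix–vector product) and with every coordinate w_k(t) > 0 for all t ∈ (t₁, t₂). Then for all t₁ < s ≤ t < t₂ one has ∑_k w_k(t) ≤ exp(−∫_s^t α(τ) dτ) · ∑_k w_k(s). -/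
open Matrix

/-- If every column sum of `A` is at most `c`, then the coordinate sum of `A *ᵥ v` is at most
`c` times that of `v`, for nonnegative `v`. -/
theorem sum_mulVec_le_of_colSum_le {m n : Type*} [Fintype m] [Fintype n]
    {A : Matrix m n ℝ} {c : ℝ} {v : n → ℝ} (hA : ∀ j, ∑ i, A i j ≤ c) (hv : ∀ j, 0 ≤ v j) :
    ∑ i, (A *ᵥ v) i ≤ c * ∑ j, v j := by
  simp only [Matrix.mulVec, dotProduct]
  rw [Finset.sum_comm, Finset.mul_sum]
  refine Finset.sum_le_sum fun j _ => ?_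
  rw [← Finset.sum_mul]
  exact mul_le_mul_of_nonneg_right (hA j) (hv j)

/-- Grönwall's inequality in differential form with a continuous rate: if `u' ≤ -a u` on
`[s, t]`, then `u t ≤ exp (-∫ a) * u s`. -/
theorem le_exp_neg_integral_mul_of_hasDerivAt_le {a u u' : ℝ → ℝ} (ha : Continuous a)
    {s t : ℝ} (hst : s ≤ t) (hu : ∀ x ∈ Set.Icc s t, HasDerivAt u (u' x) x)
    (hle : ∀ x ∈ Set.Icc s t, u' x ≤ -a x * u x) :
    u t ≤ Real.exp (-∫ τ in s..t, a τ) * u s := by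
  have hderiv : ∀ x ∈ Set.Icc s t, HasDerivAt (fun y => Real.exp (∫ τ in s..y, a τ) * u y)
      (Real.exp (∫ τ in s..x, a τ) * a x * u x + Real.exp (∫ τ in s..x, a τ) * u' x) x :=
    fun x hx => ((ha.integral_hasStrictDerivAt s x).hasDerivAt.exp).mul (hu x hx)
  have hanti : AntitoneOn (fun y => Real.exp (∫ τ in s..y, a τ) * u y) (Set.Icc s t) := by
    refine antitoneOn_of_hasDerivWithinAt_nonpos (convex_Icc s t)
      (fun x hx => (hderiv x hx).continuousAt.continuousWithinAt)
      (fun x hx => (hderiv x (interior_subset hx)).hasDerivWithinAt) fun x hx => ?_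
    have h := hle x (interior_subset hx)
    rw [mul_assoc, ← mul_add]
    exact mul_nonpos_of_nonneg_of_nonpos (Real.exp_pos _).le (by linarith)
  have h := hanti (Set.left_mem_Icc.2 hst) (Set.right_mem_Icc.2 hst) hst
  simp only [intervalIntegral.integral_same, Real.exp_zero, one_mul] at h
  rwa [Real.exp_neg, inv_mul_eq_div, le_div_iff₀' (Real.exp_pos _)]

/-- Core differential inequality (inequalities (14)–(15)): for a finite linear ODE system
`w' = B(t) w` whose matrix has all column sums bounded above by `−α(t)` on `(t₁, t₂)`,
any coordinatewise positive solution satisfies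
`∑ k, w k (t) ≤ exp(−∫_s^t α) * ∑ k, w k (s)`. -/
theorem stmt_0 (S : ℕ) (hS : 0 < S)
    (B : ℝ → Matrix (Fin S) (Fin S) ℝ)
    (hBcont : ∀ i j, Continuous fun t => B t i j)
    (α : ℝ → ℝ) (hαcont : Continuous α)
    (t₁ t₂ : ℝ) (ht : t₁ < t₂)
    (hcol : ∀ t ∈ Set.Ioo t₁ t₂, ∀ j, (∑ i, B t i j) ≤ -α t)
    (w : ℝ → Fin S → ℝ)
    (hw : ∀ t ∈ Set.Ioo t₁ t₂, HasDerivAt w (B t *ᵥ w t) t)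
    (hpos : ∀ t ∈ Set.Ioo t₁ t₂, ∀ k, 0 < w t k) :
    ∀ s t : ℝ, t₁ < s → s ≤ t → t < t₂ →
      ∑ k, w t k ≤ Real.exp (-∫ τ in s..t, α τ) * ∑ k, w s k := by
  intro s t hs hst htt
  have hmem : ∀ x ∈ Set.Icc s t, x ∈ Set.Ioo t₁ t₂ := fun x hx =>
    ⟨hs.trans_le hx.1, hx.2.trans_lt htt⟩
  exact le_exp_neg_integral_mul_of_hasDerivAt_le (u := fun x => ∑ k, w x k)
    (u' := fun x => ∑ k, (B x *ᵥ w x) k) hαcont hst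
    (fun x hx => HasDerivAt.fun_sum fun k _ => hasDerivAt_pi.1 (hw x (hmem x hx)) k)
    (fun x hx => sum_mulVec_le_of_colSum_le (hcol x (hmem x hx))
      fun k => (hpos x (hmem x hx) k).le)
end

section
/- Let S be a positive integer, B : ℝ → Matrix (Fin S) (Fin S) ℝ with continuous entries, α : ℝ → ℝ continuous, and d : Fin S → ℝ with every d_k ≠ 0. Define the transformed matrix B**(t) by B**(t)_{ij} = (d_i / d_j) · B(t)_{ij}. Fix t₁ < t₂ and suppose that for every t ∈ (t₁, t₂) and every column j one has ∑_i B**(t)_{ij} ≤ −α(t). Let x : (t₁, t₂) → (Fin S → ℝ) be differentiable with x'(t) = B(t) ·ᵥ x(t), and suppose d_k · x_k(t) > 0 for every coordinate k and every t ∈ (t₁, t₂). Then for all t₁ < s ≤ t < t₂: ∑_k |x_k(t)| ≤ (max_k |d_k| / min_m |d_m|) · exp(−∫_s^t α(τ) dτ) · ∑_k |x_k(s)|. -/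
open Matrix

/-- Grönwall's inequality with a continuous, variable rate. -/
theorem le_exp_neg_integral_mul_of_deriv_le {y y' α : ℝ → ℝ} (hα : Continuous α) {s t : ℝ}
    (hst : s ≤ t) (hy : ∀ τ ∈ Set.Icc s t, HasDerivAt y (y' τ) τ)
    (hle : ∀ τ ∈ Set.Icc s t, y' τ ≤ -α τ * y τ) :
    y t ≤ Real.exp (-∫ τ in s..t, α τ) * y s := by
  have hderiv : ∀ τ ∈ Set.Icc s t, HasDerivAt (fun τ => Real.exp (∫ u in s..τ, α u) * y τ)
      (Real.exp (∫ u in s..τ, α u) * α τ * y τ + Real.exp (∫ u in s..τ, α u) * y' τ) τ :=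
    fun τ hτ => (hα.integral_hasStrictDerivAt s τ).hasDerivAt.exp.mul (hy τ hτ)
  have hanti : AntitoneOn (fun τ => Real.exp (∫ u in s..τ, α u) * y τ) (Set.Icc s t) := by
    refine antitoneOn_of_hasDerivWithinAt_nonpos (convex_Icc s t)
      (fun τ hτ => (hderiv τ hτ).continuousAt.continuousWithinAt)
      (fun τ hτ => (hderiv τ (interior_subset hτ)).hasDerivWithinAt) fun τ hτ => ?_
    have h := mul_le_mul_of_nonneg_left (hle τ (interior_subset hτ))
      (Real.exp_pos (∫ u in s..τ, α u)).le
    linarith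
  have h := hanti (Set.left_mem_Icc.2 hst) (Set.right_mem_Icc.2 hst) hst
  simp only [intervalIntegral.integral_same, Real.exp_zero, one_mul] at h
  rwa [Real.exp_neg, inv_mul_eq_div, le_div_iff₀' (Real.exp_pos _)]

/-- If the column sums of `D B D⁻¹` are at most `c` and `d` matches the signs of `x`, then
`∑ d i * (B x) i ≤ c * ∑ d i * x i`. -/
theorem dotProduct_mulVec_le_of_column_sum_le {ι : Type*} [Fintype ι] {B : Matrix ι ι ℝ}
    {d x : ι → ℝ} {c : ℝ} (hcol : ∀ j, ∑ i, (d i / d j) * B i j ≤ c)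
    (hsign : ∀ k, 0 < d k * x k) : d ⬝ᵥ (B *ᵥ x) ≤ c * (d ⬝ᵥ x) := by
  have h : d ⬝ᵥ (B *ᵥ x) = ∑ j, (∑ i, (d i / d j) * B i j) * (d j * x j) := by
    simp only [dotProduct, mulVec, Finset.mul_sum, Finset.sum_mul]
    rw [Finset.sum_comm]
    refine Finset.sum_congr rfl fun j _ => Finset.sum_congr rfl fun i _ => ?_
    have hd : d j ≠ 0 := left_ne_zero_of_mul (hsign j).ne'
    field_simp
  rw [h, dotProduct, Finset.mul_sum]
  exact Finset.sum_le_sum fun j _ => mul_le_mul_of_nonneg_right (hcol j) (hsign j).le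

/-- Inequality (17) of the paper: on an interval where the coordinates of a solution of
`x' = B(t) x` have constant signs matching a nonzero weight vector `d`, and where the column
sums of `B**(t) = D B(t) D⁻¹` (entries `(d i / d j) * B t i j`) are bounded by `−α(t)`,
the ℓ¹-norm of the solution decays like `(max|d_k|/min|d_m|) exp(−∫ α)`. -/
theorem stmt_1 (S : ℕ) (hS : 0 < S)
    (B : ℝ → Matrix (Fin S) (Fin S) ℝ)
    (hBcont : ∀ i j, Continuous fun t => B t i j)
    (α : ℝ → ℝ) (hαcont : Continuous α)
    (d : Fin S → ℝ) (hd : ∀ k, d k ≠ 0)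
    (t₁ t₂ : ℝ) (ht : t₁ < t₂)
    (hcol : ∀ t ∈ Set.Ioo t₁ t₂, ∀ j, (∑ i, (d i / d j) * B t i j) ≤ -α t)
    (x : ℝ → Fin S → ℝ)
    (hx : ∀ t ∈ Set.Ioo t₁ t₂, HasDerivAt x (B t *ᵥ x t) t)
    (hsign : ∀ t ∈ Set.Ioo t₁ t₂, ∀ k, 0 < d k * x t k) :
    ∀ s t : ℝ, t₁ < s → s ≤ t → t < t₂ →
      ∑ k, |x t k| ≤
        ((Finset.univ.sup' ⟨⟨0, hS⟩, Finset.mem_univ _⟩ fun k => |d k|) /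
            (Finset.univ.inf' ⟨⟨0, hS⟩, Finset.mem_univ _⟩ fun m => |d m|)) *
          Real.exp (-∫ τ in s..t, α τ) * ∑ k, |x s k| := by
  intro s t hs hst htt
  have hmem : ∀ τ ∈ Set.Icc s t, τ ∈ Set.Ioo t₁ t₂ :=
    fun τ hτ => ⟨hs.trans_le hτ.1, hτ.2.trans_lt htt⟩
  have hdecay : d ⬝ᵥ x t ≤ Real.exp (-∫ τ in s..t, α τ) * (d ⬝ᵥ x s) := by
    refine le_exp_neg_integral_mul_of_deriv_le (y := fun τ => d ⬝ᵥ x τ)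
      (y' := fun τ => d ⬝ᵥ (B τ *ᵥ x τ)) hαcont hst (fun τ hτ => ?_) fun τ hτ =>
        dotProduct_mulVec_le_of_column_sum_le (hcol τ (hmem τ hτ)) (hsign τ (hmem τ hτ))
    exact HasDerivAt.fun_sum fun k _ =>
      (hasDerivAt_pi.1 (hx τ (hmem τ hτ)) k).const_mul (d k)
  have habs : ∀ τ ∈ Set.Icc s t, d ⬝ᵥ x τ = ∑ k, |d k| * |x τ k| := fun τ hτ =>
    Finset.sum_congr rfl fun k _ => by
      rw [← abs_mul, abs_of_pos (hsign τ (hmem τ hτ) k)]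
  rw [habs t (Set.right_mem_Icc.2 hst), habs s (Set.left_mem_Icc.2 hst)] at hdecay
  have hne : (Finset.univ : Finset (Fin S)).Nonempty := ⟨⟨0, hS⟩, Finset.mem_univ _⟩
  set M := Finset.univ.sup' hne fun k => |d k|
  set m := Finset.univ.inf' hne fun k => |d k|
  have hm : 0 < m := (Finset.lt_inf'_iff hne).2 fun k _ => abs_pos.2 (hd k)
  have hlower : m * ∑ k, |x t k| ≤ ∑ k, |d k| * |x t k| := by
    rw [Finset.mul_sum]
    exact Finset.sum_le_sum fun k hk =>
      mul_le_mul_of_nonneg_right (Finset.inf'_le _ hk) (abs_nonneg _)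
  have hupper : ∑ k, |d k| * |x s k| ≤ M * ∑ k, |x s k| := by
    rw [Finset.mul_sum]
    exact Finset.sum_le_sum fun k hk =>
      mul_le_mul_of_nonneg_right (Finset.le_sup' (fun k => |d k|) hk) (abs_nonneg _)
  rw [div_mul_eq_mul_div, div_mul_eq_mul_div, le_div_iff₀' hm]
  calc m * ∑ k, |x t k| ≤ Real.exp (-∫ τ in s..t, α τ) * ∑ k, |d k| * |x s k| :=
        hlower.trans hdecay
    _ ≤ Real.exp (-∫ τ in s..t, α τ) * (M * ∑ k, |x s k|) := by gcongr
    _ = M * Real.exp (-∫ τ in s..t, α τ) * ∑ k, |x s k| := by ring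
end

section
/- Let y : ℕ → ℝ (indexed by i ≥ 1) be absolutely summable and for each k ≥ 1 set u_k := ∑_{i ≥ k} y_i. Let (d_k)_{k ≥ 1} be real numbers with inf_k |d_k| = d > 0, and suppose ∑_{k ≥ 1} |d_k| |u_k| < ∞. Then |∑_{i ≥ 1} y_i| + ∑_{i ≥ 1} |y_i| ≤ (2/d) · ∑_{k ≥ 1} |d_k| |u_k|. -/
/-- Norm comparison used in the final step of the paper's Theorem:
if `y = (y_1, y_2, …)` (here indexed from `0`) is absolutely summable,
`u_k = ∑_{i ≥ k} y_i` are its tail sums, and the weights `d_k` satisfy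
`inf_k |d_k| = d > 0`, then `|∑ y_i| + ∑ |y_i| ≤ (2/d) ∑ |d_k| |u_k|`. -/
theorem stmt_7 (y : ℕ → ℝ) (hy : Summable fun i => |y i|)
    (u : ℕ → ℝ) (hu : ∀ k, u k = ∑' i : ℕ, y (k + i))
    (d : ℕ → ℝ) (dd : ℝ) (hdd : 0 < dd)
    (hinf : IsGLB (Set.range fun k => |d k|) dd)
    (hsum : Summable fun k => |d k| * |u k|) :
    |∑' i, y i| + (∑' i, |y i|) ≤ (2 / dd) * ∑' k, |d k| * |u k| := by
  have hstep : ∀ k, y k = u k - u (k + 1) := by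
    intro k
    have hk : Summable fun i => y (k + i) := by
      simpa only [add_comm] using (summable_nat_add_iff k).2 hy.of_abs
    rw [hu k, hu (k + 1), hk.tsum_eq_zero_add]
    simp [add_assoc, add_comm 1]
  have hle : ∀ k, dd * |u k| ≤ |d k| * |u k| := fun k =>
    mul_le_mul_of_nonneg_right (hinf.1 ⟨k, rfl⟩) (abs_nonneg _)
  have hmul : Summable fun k => dd * |u k| :=
    hsum.of_nonneg_of_le (fun k => by positivity) hle
  have hU : Summable fun k => |u k| := (summable_mul_left_iff hdd.ne').1 hmul
  have hU' : Summable fun k => |u (k + 1)| := (summable_nat_add_iff 1).2 hU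
  have hweighted : dd * ∑' k, |u k| ≤ ∑' k, |d k| * |u k| := by
    rw [← tsum_mul_left]
    exact hmul.tsum_le_tsum hle hsum
  have hy_le : ∑' i, |y i| ≤ ∑' k, |u k| + ∑' k, |u (k + 1)| := by
    rw [← hU.tsum_add hU']
    refine hy.tsum_le_tsum (fun k => ?_) (hU.add hU')
    rw [hstep k]
    exact abs_sub _ _
  have hshift : ∑' k, |u k| = |u 0| + ∑' k, |u (k + 1)| := hU.tsum_eq_zero_add
  have hzero : ∑' i, y i = u 0 := by simp [hu 0]
  calc |∑' i, y i| + (∑' i, |y i|) ≤ 2 * ∑' k, |u k| := by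
        rw [hzero]; linarith
    _ = (2 / dd) * (dd * ∑' k, |u k|) := by field_simp
    _ ≤ (2 / dd) * ∑' k, |d k| * |u k| := by gcongr
end

section
/- Let n be a positive integer and let A : ℝ → Matrix (Fin n) (Fin n) ℝ have continuous entries with A(t)_{ij} ≥ 0 for all i ≠ j and ∑_{i} A(t)_{ij} = 0 for every column j and every t. Let p : [s, ∞) → (Fin n → ℝ) be differentiable with p'(t) = A(t) ·ᵥ p(t), and suppose p(s) is a stochastic vector, i.e. p_k(s) ≥ 0 for all k and ∑_k p_k(s) = 1. Then for every t ≥ s, p(t) is a stochastic vector: p_k(t) ≥ 0 for all k and ∑_k p_k(t) = 1. -/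
open Matrix

/-- The square of the negative part of a real number is differentiable. -/
theorem hasDerivAt_min_zero_sq (x : ℝ) :
    HasDerivAt (fun y : ℝ => (min y 0) ^ 2) (2 * min x 0) x := by
  rw [hasDerivAt_iff_isLittleO]
  refine Asymptotics.IsBigO.trans_isLittleO (g := fun y => (y - x) ^ 2) ?_ ?_
  · refine Asymptotics.IsBigO.of_bound 1 (Filter.Eventually.of_forall fun y => ?_)
    rw [Real.norm_eq_abs, Real.norm_eq_abs, abs_of_nonneg (sq_nonneg (y - x)), one_mul,
      smul_eq_mul, abs_le]
    rcases le_total x 0 with hx | hx <;> rcases le_total y 0 with hy | hy <;>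
      simp only [min_eq_left, min_eq_right, hx, hy] <;> constructor <;>
      nlinarith [sq_nonneg (y - x), sq_nonneg x, sq_nonneg y]
  · have h := (Asymptotics.isLittleO_pow_id (𝕜 := ℝ) one_lt_two)
    have ht : Filter.Tendsto (fun y : ℝ => y - x) (nhds x) (nhds 0) :=
      tendsto_sub_nhds_zero_iff.2 Filter.tendsto_id
    exact h.comp_tendsto ht

/-- The quadratic form estimate behind positivity of flows of Metzler matrices. -/
theorem sum_min_zero_mul_mulVec_le {ι : Type*} [Fintype ι] (A : Matrix ι ι ℝ)
    (hoff : ∀ i j, i ≠ j → 0 ≤ A i j) {C : ℝ} (hC : ∀ i j, |A i j| ≤ C) (x : ι → ℝ) :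
    ∑ k, 2 * min (x k) 0 * (A *ᵥ x) k ≤ 2 * Fintype.card ι * C * ∑ k, (min (x k) 0) ^ 2 := by
  have hterm : ∀ k j, 2 * min (x k) 0 * (A k j * x j) ≤
      C * ((min (x k) 0) ^ 2 + (min (x j) 0) ^ 2) := by
    intro k j
    have hreduce : min (x k) 0 * (A k j * x j) ≤ A k j * (min (x k) 0 * min (x j) 0) := by
      rcases eq_or_ne k j with rfl | hkj
      · rcases le_total (x k) 0 with h | h
        · rw [min_eq_left h]; exact le_of_eq (by ring)
        · simp [min_eq_right h]
      · have h := mul_le_mul_of_nonpos_left (min_le_left (x j) 0) (min_le_right (x k) 0)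
        nlinarith [mul_le_mul_of_nonneg_left h (hoff k j hkj)]
    have hprod : 0 ≤ min (x k) 0 * min (x j) 0 :=
      mul_nonneg_of_nonpos_of_nonpos (min_le_right _ _) (min_le_right _ _)
    have hCnonneg : 0 ≤ C := (abs_nonneg _).trans (hC k j)
    have hbound := mul_le_mul_of_nonneg_right ((le_abs_self _).trans (hC k j)) hprod
    nlinarith [mul_nonneg hCnonneg (sq_nonneg (min (x k) 0 - min (x j) 0))]
  calc ∑ k, 2 * min (x k) 0 * (A *ᵥ x) k
      = ∑ k, ∑ j, 2 * min (x k) 0 * (A k j * x j) := by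
        simp only [Matrix.mulVec, dotProduct, Finset.mul_sum]
    _ ≤ ∑ k, ∑ j, C * ((min (x k) 0) ^ 2 + (min (x j) 0) ^ 2) :=
        Finset.sum_le_sum fun k _ => Finset.sum_le_sum fun j _ => hterm k j
    _ = 2 * Fintype.card ι * C * ∑ k, (min (x k) 0) ^ 2 := by
        simp only [← Finset.mul_sum, Finset.sum_add_distrib, Finset.sum_const, Finset.card_univ,
          nsmul_eq_mul]
        ring

/-- A nonnegative function vanishing at the left endpoint with `h' ≤ K h` vanishes. -/
theorem eq_zero_of_hasDerivAt_le_mul {h h' : ℝ → ℝ} {K a b : ℝ} (hab : a ≤ b)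
    (hderiv : ∀ t ∈ Set.Icc a b, HasDerivAt h (h' t) t)
    (hle : ∀ t ∈ Set.Icc a b, h' t ≤ K * h t) (hnonneg : 0 ≤ h b) (ha : h a = 0) : h b = 0 := by
  have hd : ∀ t ∈ Set.Icc a b, HasDerivAt (fun u => h u * Real.exp (-K * u))
      (h' t * Real.exp (-K * t) + h t * (Real.exp (-K * t) * (-K * 1))) t := fun t ht =>
    (hderiv t ht).mul (((hasDerivAt_id t).const_mul (-K)).exp)
  have hanti : AntitoneOn (fun u => h u * Real.exp (-K * u)) (Set.Icc a b) := by
    refine antitoneOn_of_deriv_nonpos (convex_Icc a b)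
      (fun t ht => (hd t ht).continuousAt.continuousWithinAt)
      (fun t ht => (hd t (interior_subset ht)).differentiableAt.differentiableWithinAt)
      fun t ht => ?_
    rw [(hd t (interior_subset ht)).deriv]
    nlinarith [mul_le_mul_of_nonneg_right (hle t (interior_subset ht)) (Real.exp_pos (-K * t)).le]
  have hfinal := hanti (Set.left_mem_Icc.2 hab) (Set.right_mem_Icc.2 hab) hab
  simp only [ha, zero_mul] at hfinal
  exact le_antisymm (nonpos_of_mul_nonpos_left hfinal (Real.exp_pos _)) hnonneg

/-- The entries of a continuous matrix function are uniformly bounded on compact sets. -/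
theorem exists_forall_abs_entry_le {ι : Type*} [Finite ι] {A : ℝ → Matrix ι ι ℝ}
    (hA : ∀ i j, Continuous fun t => A t i j) {S : Set ℝ} (hS : IsCompact S) :
    ∃ C, ∀ t ∈ S, ∀ i j, |A t i j| ≤ C := by
  choose c hc using fun i j => hS.exists_bound_of_continuousOn (hA i j).continuousOn
  obtain ⟨C, hC⟩ := Set.finite_range (fun q : ι × ι => c q.1 q.2) |>.bddAbove
  exact ⟨C, fun t ht i j => (hc i j t ht).trans (hC ⟨(i, j), rfl⟩)⟩

/-- If `p(s)` is a stochastic vector, then the solution of the forward Kolmogorov system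
`p' = A(t) p` (with `A(t)` a transposed intensity matrix: nonnegative off-diagonal entries
and zero column sums) remains a stochastic vector for all `t ≥ s`. -/
theorem stmt_9 (n : ℕ) (hn : 0 < n)
    (A : ℝ → Matrix (Fin n) (Fin n) ℝ)
    (hAcont : ∀ i j, Continuous fun t => A t i j)
    (hoff : ∀ t : ℝ, ∀ i j, i ≠ j → 0 ≤ A t i j)
    (hcol : ∀ t : ℝ, ∀ j, (∑ i, A t i j) = 0)
    (s : ℝ) (p : ℝ → Fin n → ℝ)
    (hp : ∀ t : ℝ, s ≤ t → HasDerivAt p (A t *ᵥ p t) t)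
    (hps_nonneg : ∀ k, 0 ≤ p s k) (hps_sum : (∑ k, p s k) = 1) :
    ∀ t : ℝ, s ≤ t → (∀ k, 0 ≤ p t k) ∧ (∑ k, p t k) = 1 := by
  intro t hst
  have hcoord : ∀ k, ∀ u ∈ Set.Icc s t, HasDerivAt (fun v => p v k) ((A u *ᵥ p u) k) u :=
    fun k u hu => hasDerivAt_pi.1 (hp u hu.1) k
  constructor
  · obtain ⟨C, hC⟩ := exists_forall_abs_entry_le hAcont (isCompact_Icc (a := s) (b := t))
    have hzero : ∑ k, (min (p t k) 0) ^ 2 = 0 :=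
      eq_zero_of_hasDerivAt_le_mul (h := fun u => ∑ k, (min (p u k) 0) ^ 2)
        (h' := fun u => ∑ k, 2 * min (p u k) 0 * (A u *ᵥ p u) k) hst
        (fun u hu => HasDerivAt.fun_sum fun k _ =>
          (hasDerivAt_min_zero_sq (p u k)).comp (h := fun v => p v k) u (hcoord k u hu))
        (fun u hu => sum_min_zero_mul_mulVec_le (A u) (hoff u) (hC u hu) (p u))
        (Finset.sum_nonneg fun k _ => sq_nonneg _)
        (by simp [min_eq_right (hps_nonneg _)])
    intro k
    have hk := (Finset.sum_eq_zero_iff_of_nonneg fun k _ => sq_nonneg _).1 hzero k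
      (Finset.mem_univ k)
    exact min_eq_right_iff.1 (pow_eq_zero_iff two_ne_zero |>.1 hk)
  · have hsum : ∀ u ∈ Set.Icc s t, HasDerivAt (fun v => ∑ k, p v k) 0 u := by
      intro u hu
      have hzero : ∑ k, (A u *ᵥ p u) k = 0 := by
        simp only [Matrix.mulVec, dotProduct]
        rw [Finset.sum_comm]
        simp [← Finset.sum_mul, hcol]
      rw [← hzero]
      exact HasDerivAt.fun_sum fun k _ => hcoord k u hu
    rw [← hps_sum]
    exact constant_of_has_deriv_right_zero
      (fun u hu => (hsum u hu).continuousAt.continuousWithinAt)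
      (fun u hu => (hsum u (Set.Ico_subset_Icc_self hu)).hasDerivWithinAt) t
      (Set.right_mem_Icc.2 hst)
end

section
/- Let λ ≥ 0, μ ≥ 0 be real numbers and δ > 1. Define the infinite matrix B* (rows and columns indexed by k ≥ 1) by: B*_{1,1} = −λ; B*_{k,k} = −(λ + μ) for k ≥ 2; B*_{k+1,k} = λ for k ≥ 1; B*_{1,2} = −μ; B*_{k,k+2} = μ for k ≥ 1; and all other entries zero. Define weights d₁ = 1, d₂ = 1/δ, and d_k = δ^{k−2} for k ≥ 3. Then for every column j ≥ 1: ∑_{i} (d_i / d_j) · B*_{ij} ≤ −min( λ(1 − δ^{−1}), μ(1 + δ) − λ(δ² − 1), μ(1 − δ^{−1}) − λ(δ − 1) ). -/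
/-- Column-sum computation behind inequality (38) for the `M_t/M_t^{(2)}/1` model.
Indices here run over `ℕ` starting at `0`, corresponding to the paper's indices `k ≥ 1`
(so Lean index `k` is the paper's `k + 1`).  The matrix `B*` of the paper has
`B*_{1,1} = −λ`, `B*_{k,k} = −(λ+μ)` for `k ≥ 2`, `B*_{k+1,k} = λ`, `B*_{1,2} = −μ`,
`B*_{k,k+2} = μ`, and zeros elsewhere; the weights are `d₁ = 1`, `d₂ = 1/δ`,
`d_k = δ^{k−2}` for `k ≥ 3`.  Every column sum of `D B* D⁻¹` is at most
`−min(λ(1−δ⁻¹), μ(1+δ) − λ(δ²−1), μ(1−δ⁻¹) − λ(δ−1))`. -/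
theorem stmt_10 (lam mu δ : ℝ) (hlam : 0 ≤ lam) (hmu : 0 ≤ mu) (hδ : 1 < δ)
    (B : ℕ → ℕ → ℝ)
    (hB : B = fun i j =>
      if i = 0 ∧ j = 0 then -lam
      else if i = j then -(lam + mu)
      else if i = j + 1 then lam
      else if i = 0 ∧ j = 1 then -mu
      else if j = i + 2 then mu
      else 0)
    (d : ℕ → ℝ)
    (hd : d = fun k => if k = 0 then 1 else if k = 1 then 1 / δ else δ ^ (k - 1)) :
    ∀ j : ℕ, (∑' i, (d i / d j) * B i j) ≤
      -min (min (lam * (1 - δ⁻¹)) (mu * (1 + δ) - lam * (δ ^ 2 - 1)))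
        (mu * (1 - δ⁻¹) - lam * (δ - 1)) := by
  have hδ0 : 0 < δ := by linarith
  have hinv : δ⁻¹ ≤ 1 := inv_le_one_of_one_le₀ hδ.le
  intro j
  rcases j with _ | _ | m
  · have hs : ∑' i, (d i / d 0) * B i 0 = ∑ i ∈ ({0, 1} : Finset ℕ), (d i / d 0) * B i 0 := by
      refine tsum_eq_sum fun i hi => ?_
      simp only [Finset.mem_insert, Finset.mem_singleton, not_or] at hi
      simp [hB, hi.1, hi.2]
    have hv : ∑' i, (d i / d 0) * B i 0 = -(lam * (1 - δ⁻¹)) := by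
      rw [hs]
      simp [hB, hd]
      ring
    rw [hv]
    exact neg_le_neg ((min_le_left _ _).trans (min_le_left _ _))
  · have hs : ∑' i, (d i / d 1) * B i 1 = ∑ i ∈ ({0, 1, 2} : Finset ℕ), (d i / d 1) * B i 1 := by
      refine tsum_eq_sum fun i hi => ?_
      simp only [Finset.mem_insert, Finset.mem_singleton, not_or] at hi
      simp [hB, hi.1, hi.2.1, hi.2.2]
    have hv : ∑' i, (d i / d 1) * B i 1 = -(mu * (1 + δ) - lam * (δ ^ 2 - 1)) := by
      rw [hs]
      simp [hB, hd]
      field_simp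
      ring
    rw [zero_add, hv]
    exact neg_le_neg ((min_le_left _ _).trans (min_le_right _ _))
  · have hs : ∑' i, (d i / d (m + 2)) * B i (m + 2) =
        ∑ i ∈ ({m, m + 2, m + 3} : Finset ℕ), (d i / d (m + 2)) * B i (m + 2) := by
      refine tsum_eq_sum fun i hi => ?_
      simp only [Finset.mem_insert, Finset.mem_singleton, not_or] at hi
      have hm : ¬ m = i := fun h => hi.1 h.symm
      simp [hB, hi.2.1, hi.2.2, hm]
    have hdm : d (m + 2) = δ ^ (m + 1) := by simp [hd]
    have hdm' : d (m + 3) = δ ^ (m + 2) := by simp [hd]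
    have hv : ∑' i, (d i / d (m + 2)) * B i (m + 2) =
        d m / d (m + 2) * mu - (lam + mu) + lam * δ := by
      rw [hs, Finset.sum_insert (by simp), Finset.sum_insert (by simp), Finset.sum_singleton]
      have h1 : B m (m + 2) = mu := by
        have hm : m ≠ m + 2 + 1 := by omega
        simp [hB, hm]
      have h2 : B (m + 2) (m + 2) = -(lam + mu) := by simp [hB]
      have h3 : B (m + 3) (m + 2) = lam := by simp [hB]
      rw [h1, h2, h3, hdm, hdm']
      field_simp
      ring
    have hle : d m ≤ δ ^ m := by
      rcases m with _ | _ | n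
      · simp [hd]
      · simp only [hd]
        norm_num
        linarith
      · simp only [hd]
        norm_num
        exact pow_le_pow_right₀ hδ.le (by omega)
    have hr : d m / d (m + 2) ≤ δ⁻¹ := by
      rw [hdm, div_le_iff₀ (by positivity), pow_succ', inv_mul_cancel_left₀ hδ0.ne']
      exact hle
    have hmul := mul_le_mul_of_nonneg_right hr hmu
    rw [hv]
    refine le_trans ?_ (neg_le_neg (min_le_right _ _))
    linarith
end
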